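/- arXiv:2010.08664 — 2 statements merged into one kernel-verified Lean document; each statement's English description precedes it below -/
import Mathlib

section
/- The underlying graph of an oriented circular-arc catch digraph cannot contain the complement of the cycle C_8 as an induced subgraph. -/
/-- Membership in the closed clockwise circular arc starting at `a` of length `ℓ`
on a circle of circumference 1 (points are reals modulo 1). -/
def arcMem (a ℓ x : ℝ) : Prop := Int.fract (x - a) ≤ ℓ

/-- The set of points of the circle (reals, modulo 1) lying on the arc. -/
def arcSet (a ℓ : ℝ) : Set ℝ := {x | arcMem a ℓ x}

/-- `E` is a circular-arc catch digraph: each vertex `v` carries a circular arc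
(start `a v`, length `ℓ v`) and a point `p v` inside its own arc, and
`E u v` iff `u ≠ v` and the point of `v` lies in the arc of `u`. -/
def IsCACatchDigraph {V : Type*} (E : V → V → Prop) : Prop :=
  ∃ a ℓ p : V → ℝ, (∀ v, arcMem (a v) (ℓ v) (p v)) ∧
    ∀ u v, E u v ↔ u ≠ v ∧ arcMem (a u) (ℓ u) (p v)

/-- Proper circular-arc catch digraph: as above, with no arc properly contained
in another. -/
def IsProperCACatchDigraph {V : Type*} (E : V → V → Prop) : Prop :=
  ∃ a ℓ p : V → ℝ, (∀ v, arcMem (a v) (ℓ v) (p v)) ∧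
    (∀ u v : V, ¬ arcSet (a u) (ℓ u) ⊂ arcSet (a v) (ℓ v)) ∧
    ∀ u v, E u v ↔ u ≠ v ∧ arcMem (a u) (ℓ u) (p v)

/-- A digraph is oriented: no pair of vertices has edges in both directions. -/
def Oriented {V : Type*} (E : V → V → Prop) : Prop := ∀ u v, E u v → ¬ E v u

/-- A subset of `Fin n` is a circular (cyclically consecutive) block. -/
def CircBlock {n : ℕ} (S : Set (Fin n)) : Prop :=
  S = ∅ ∨ ∃ a b : Fin n, S = {i | i - a ≤ b - a}


namespace CatchDigraph

/-- Whether two vertices are consecutive in `C_8`. -/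
def cycleAdj (i j : Fin 8) : Bool :=
  Nat.beq j.val ((i.val + 1) % 8) || Nat.beq i.val ((j.val + 1) % 8)

theorem cycleAdj_iff {i j : Fin 8} :
    cycleAdj i j = true ↔ j.val = (i.val + 1) % 8 ∨ i.val = (j.val + 1) % 8 := by
  simp [cycleAdj]

/-- `hasAlt f o n b`: the list `o` has a sublist of length `n` on which `f` takes the
values `b, !b, b, …`. It is written with recursors to reduce quickly in the kernel. -/
def hasAlt {α : Type*} (f : α → Bool) (o : List α) : ℕ → Bool → Bool :=
  List.rec (fun n _ => Nat.beq n 0)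
    (fun c _ ih n b => Nat.rec true (fun m _ => cond (f c == b) (ih m !b) (ih n b)) n) o

section Alternation

variable {α : Type*} {f : α → Bool} {n : ℕ} {b : Bool} {o : List α}

theorem exists_of_hasAlt_succ (h : hasAlt f o (n + 1) b = true) :
    ∃ w s, (w :: s).Sublist o ∧ f w = b ∧ hasAlt f s n (!b) = true := by
  induction o with
  | nil => simp [hasAlt] at h
  | cons c s ih =>
    change cond (f c == b) (hasAlt f s n !b) (hasAlt f s (n + 1) b) = true at h
    by_cases hc : f c = b
    · exact ⟨c, s, List.Sublist.refl _, hc, by simpa [hc] using h⟩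
    · obtain ⟨w, t, hs, hw, ht⟩ := ih (by simpa [hc] using h)
      exact ⟨w, t, hs.cons c, hw, ht⟩

theorem exists_of_hasAlt_four (h : hasAlt f o 4 b = true) :
    ∃ w x y z, [w, x, y, z].Sublist o ∧ f w = b ∧ f x = !b ∧ f y = b ∧ f z = !b := by
  obtain ⟨w, s, hs, hw, h⟩ := exists_of_hasAlt_succ h
  obtain ⟨x, t, ht, hx, h⟩ := exists_of_hasAlt_succ h
  obtain ⟨y, r, hr, hy, h⟩ := exists_of_hasAlt_succ h
  obtain ⟨z, k, hk, hz, -⟩ := exists_of_hasAlt_succ h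
  have hz' := (List.nil_sublist k).cons_cons z |>.trans hk
  have hy' := (hz'.cons_cons y).trans hr
  have hx' := (hy'.cons_cons x).trans ht
  exact ⟨w, x, y, z, (hx'.cons_cons w).trans hs, hw, hx, by simpa using hy, by simpa using hz⟩

end Alternation

section Insertion

variable {α : Type*}

/-- All lists obtained by inserting `v` somewhere after the head. -/
def insertAfter (v : α) : List α → List (List α)
  | [] => []
  | a :: l => (a :: v :: l) :: (insertAfter v l).map (a :: ·)

theorem exists_mem_insertAfter {β : Type*} [LinearOrder β] (q : α → β) {v a : α} {l : List α}
    (hl : (a :: l).Pairwise (q · < q ·)) (ha : q a < q v) (hv : ∀ w ∈ l, q w ≠ q v) :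
    ∃ o ∈ insertAfter v (a :: l), o.Pairwise (q · < q ·) ∧ o.Perm (v :: a :: l) := by
  induction l generalizing a with
  | nil => exact ⟨[a, v], by simp [insertAfter], by simpa using ha, List.Perm.swap _ _ _⟩
  | cons b l ih =>
    rw [List.pairwise_cons] at hl
    rcases lt_or_gt_of_ne (hv b (by simp)) with hb | hb
    · obtain ⟨o, ho, hp, hperm⟩ := ih hl.2 hb fun w hw => hv w (by simp [hw])
      refine ⟨a :: o, ?_, ?_, (hperm.cons a).trans (List.Perm.swap _ _ _)⟩
      · rw [insertAfter]
        exact List.mem_cons_of_mem _ (List.mem_map_of_mem ho)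
      · refine List.pairwise_cons.2 ⟨fun w hw => ?_, hp⟩
        rcases List.mem_cons.1 (hperm.mem_iff.1 hw) with rfl | hw
        · exact ha
        · exact hl.1 w hw
    · refine ⟨a :: v :: b :: l, by simp [insertAfter], ?_, List.Perm.swap _ _ _⟩
      have hbl := List.pairwise_cons.1 hl.2
      refine List.pairwise_cons.2 ⟨fun w hw => ?_, List.pairwise_cons.2 ⟨fun w hw => ?_, hl.2⟩⟩
      · rcases List.mem_cons.1 hw with rfl | hw
        · exact ha
        · exact hl.1 w hw
      · rcases List.mem_cons.1 hw with rfl | hw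
        · exact hb
        · exact hb.trans (hbl.1 w hw)

end Insertion

/-- Whether the arc from `u` to `w` is recorded in the bit mask `E`. -/
def hasArc (E : ℕ) (u w : Fin 8) : Bool :=
  Nat.beq (Nat.land (Nat.shiftRight E (Nat.add (Nat.mul 8 u.val) w.val)) 1) 1

/-- Record the arc from `u` to `w` in the bit mask `E`. -/
def addArc (E : ℕ) (u w : Fin 8) : ℕ :=
  Nat.lor E (Nat.pow 2 (Nat.add (Nat.mul 8 u.val) w.val))

theorem hasArc_eq_testBit (E : ℕ) (u w : Fin 8) :
    hasArc E u w = E.testBit (8 * u.val + w.val) := by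
  rw [Nat.testBit_eq_decide_div_mod_eq, ← Nat.shiftRight_eq_div_pow, ← Nat.and_one_is_mod,
    Bool.eq_iff_iff, decide_eq_true_iff]
  exact iff_of_eq Nat.beq_eq

theorem hasArc_addArc {E : ℕ} {u v a b : Fin 8} :
    hasArc (addArc E u v) a b = true ↔ hasArc E a b = true ∨ (a = u ∧ b = v) := by
  have : addArc E u v = E ||| 2 ^ (8 * u.val + v.val) := rfl
  rw [hasArc_eq_testBit, hasArc_eq_testBit, this, Nat.testBit_or, Nat.testBit_two_pow,
    Bool.or_eq_true, decide_eq_true_iff]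
  lia

/-- The out-neighbours of `u` in `E` do not form a circular block of the list `o`. -/
def rowBad (o : List (Fin 8)) (u : Fin 8) (E : ℕ) : Bool :=
  hasAlt (hasArc E u) o 4 (hasArc E u 0)

/-- Whether `k` accepts all ways of adding to `E` one arc between `v` and each vertex of a list
adjacent to `v`, apart from those that spoil the row of such a vertex. -/
def orientAll (o : List (Fin 8)) (v : Fin 8) (k : ℕ → Bool) : List (Fin 8) → ℕ → Bool
  | [], E => k E
  | u :: us, E =>
    bif cycleAdj u v then rowBad o u E || orientAll o v k us E
    else (rowBad o u (addArc E u v) || orientAll o v k us (addArc E u v)) &&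
      (rowBad o u E || orientAll o v k us (addArc E v u))

/-- Whether there is no way of adding the listed vertices to a circular order with an orientation
encoded by a bit mask. -/
def refute : List (Fin 8) → List (Fin 8) → ℕ → Bool
  | [], _, _ => false
  | v :: vs, o, E => (insertAfter v o).all fun o' =>
      orientAll o' v (fun E' => rowBad o' v E' || refute vs o' E') o (addArc E v v)

theorem refute_eq_true : refute [1, 2, 3, 4, 5, 6, 7] [0] 1 = true := by
  decide +kernel

/-- A family of subsets `M u` of eight points on a circle cut open at the point `0`, each a circular
block, which orients the complement of `C_8`. The value `q v` is the position of the point `v`. -/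
structure IsModel (q : Fin 8 → ℝ) (M : Fin 8 → Fin 8 → Prop) : Prop where
  zero_lt : ∀ v, v ≠ 0 → q 0 < q v
  inj : Function.Injective q
  self : ∀ u, M u u
  not_of_cycleAdj : ∀ u v, u ≠ v → cycleAdj u v = true → ¬ M u v ∧ ¬ M v u
  oriented : ∀ u v, u ≠ v → ¬ cycleAdj u v = true → (M u v ∧ ¬ M v u) ∨ (¬ M u v ∧ M v u)
  block : ∀ u w x y z, q w < q x → q x < q y → q y < q z →
    ¬ (M u w ∧ ¬ M u x ∧ M u y ∧ ¬ M u z) ∧ ¬ (¬ M u w ∧ M u x ∧ ¬ M u y ∧ M u z)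

/-- The circular order `o` and the bit mask `E` describe the restriction of `q` and `M` to the
vertices listed in `o`. -/
structure Describes (q : Fin 8 → ℝ) (M : Fin 8 → Fin 8 → Prop) (o : List (Fin 8)) (E : ℕ) :
    Prop where
  head : ∃ l, o = 0 :: l
  sorted : o.Pairwise (q · < q ·)
  sound : ∀ u w, hasArc E u w = true → M u w
  complete : ∀ u ∈ o, ∀ w ∈ o, M u w → hasArc E u w = true

namespace IsModel

variable {q : Fin 8 → ℝ} {M : Fin 8 → Fin 8 → Prop} {o us : List (Fin 8)} {u v : Fin 8} {E : ℕ}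

theorem rowBad_eq_false (h : IsModel q M) (ho : o.Pairwise (q · < q ·))
    (hE : ∀ w ∈ o, hasArc E u w = true ↔ M u w) : rowBad o u E = false := by
  rw [rowBad, ← Bool.not_eq_true]
  intro ha
  obtain ⟨w, x, y, z, hs, hw, hx, hy, hz⟩ := exists_of_hasAlt_four ha
  have hp := ho.sublist hs
  have hb := h.block u w x y z (by simp_all) (by simp_all) (by simp_all)
  rw [← hE w (hs.subset (by simp)), ← hE x (hs.subset (by simp)), ← hE y (hs.subset (by simp)),
    ← hE z (hs.subset (by simp)), hw, hx, hy, hz] at hb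
  cases hasArc E u 0 <;> simp at hb

theorem sound_addArc (hm : M u v) (hE : ∀ a b, hasArc E a b = true → M a b) (a b : Fin 8)
    (hab : hasArc (addArc E u v) a b = true) : M a b := by
  rcases hasArc_addArc.1 hab with hab | ⟨rfl, rfl⟩
  · exact hE a b hab
  · exact hm

theorem exists_of_orientAll (h : IsModel q M) {k : ℕ → Bool} (hk : orientAll o v k us E = true)
    (ho : o.Pairwise (q · < q ·)) (hv : ∀ u ∈ us, u ≠ v)
    (hE : ∀ a b, hasArc E a b = true → M a b)
    (hc : ∀ u ∈ us, ∀ w ∈ o, w ≠ v → M u w → hasArc E u w = true) :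
    ∃ E', k E' = true ∧ (∀ a b, hasArc E a b = true → hasArc E' a b = true) ∧
      (∀ a b, hasArc E' a b = true → M a b) ∧
      ∀ u ∈ us, (M u v → hasArc E' u v = true) ∧ (M v u → hasArc E' v u = true) := by
  induction us generalizing E with
  | nil => exact ⟨E, hk, fun _ _ => id, hE, by simp⟩
  | cons u us ih =>
    have huv := hv u (by simp)
    have extend {E₁ : ℕ} (hk₁ : orientAll o v k us E₁ = true)
        (hsub : ∀ a b, hasArc E a b = true → hasArc E₁ a b = true)
        (hE₁ : ∀ a b, hasArc E₁ a b = true → M a b)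
        (hu : (M u v → hasArc E₁ u v = true) ∧ (M v u → hasArc E₁ v u = true)) :
        ∃ E', k E' = true ∧ (∀ a b, hasArc E a b = true → hasArc E' a b = true) ∧
          (∀ a b, hasArc E' a b = true → M a b) ∧ ∀ x ∈ u :: us,
            (M x v → hasArc E' x v = true) ∧ (M v x → hasArc E' v x = true) := by
      obtain ⟨E₂, hk₂, hsub₂, hE₂, hall⟩ := ih hk₁ (fun x hx => hv x (by simp [hx])) hE₁
        fun x hx w hw hwv hm => hsub _ _ (hc x (by simp [hx]) w hw hwv hm)
      refine ⟨E₂, hk₂, fun a b hab => hsub₂ a b (hsub a b hab), hE₂, fun x hx => ?_⟩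
      rcases List.mem_cons.1 hx with rfl | hx
      · exact ⟨fun hm => hsub₂ _ _ (hu.1 hm), fun hm => hsub₂ _ _ (hu.2 hm)⟩
      · exact hall x hx
    have row {E₁ : ℕ} (hsub : ∀ a b, hasArc E a b = true → hasArc E₁ a b = true)
        (hE₁ : ∀ a b, hasArc E₁ a b = true → M a b) (hu : M u v → hasArc E₁ u v = true) :
        rowBad o u E₁ = false := by
      refine h.rowBad_eq_false ho fun w hw => ⟨hE₁ u w, fun hm => ?_⟩
      by_cases hwv : w = v
      · subst hwv
        exact hu hm
      · exact hsub _ _ (hc u (by simp) w hw hwv hm)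
    rw [orientAll] at hk
    by_cases hadj : cycleAdj u v = true
    · have hn := h.not_of_cycleAdj u v huv hadj
      rw [hadj, cond_true, row (fun _ _ => id) hE (by tauto), Bool.false_or] at hk
      exact extend hk (fun _ _ => id) hE (by tauto)
    · rw [Bool.not_eq_true _ |>.mp hadj, cond_false, Bool.and_eq_true] at hk
      rcases h.oriented u v huv hadj with hm | hm
      · have hsub := fun a b (hab : hasArc E a b = true) =>
          hasArc_addArc (u := u) (v := v).2 (Or.inl hab)
        have hE₁ := sound_addArc hm.1 hE
        have hu : hasArc (addArc E u v) u v = true := hasArc_addArc.2 (by simp)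
        rw [row hsub hE₁ fun _ => hu, Bool.false_or] at hk
        exact extend hk.1 hsub hE₁ (by tauto)
      · rw [row (fun _ _ => id) hE (by tauto), Bool.false_or] at hk
        exact extend hk.2 (fun a b hab => hasArc_addArc.2 (Or.inl hab)) (sound_addArc hm.2 hE)
          ⟨by tauto, fun _ => hasArc_addArc.2 (by simp)⟩

theorem exists_of_refute_cons (h : IsModel q M) {vs : List (Fin 8)}
    (href : refute (v :: vs) o E = true) (hd : Describes q M o E) (hv : v ∉ o) :
    ∃ o' E', refute vs o' E' = true ∧ Describes q M o' E' ∧ o'.Perm (v :: o) := by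
  obtain ⟨⟨l, rfl⟩, hs, hE, hcomp⟩ := hd
  have hne : ∀ w ∈ (0 : Fin 8) :: l, w ≠ v := fun w hw hwv => hv (hwv ▸ hw)
  obtain ⟨o', ho', hs', hperm⟩ := exists_mem_insertAfter q hs
    (h.zero_lt v (hne 0 (by simp)).symm) fun w hw hwv => hne w (by simp [hw]) (h.inj hwv)
  have hmem : ∀ w ∈ o', w ≠ v → w ∈ (0 : Fin 8) :: l := fun w hw hwv =>
    (List.mem_cons.1 (hperm.mem_iff.1 hw)).resolve_left hwv
  rw [refute, List.all_eq_true] at href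
  obtain ⟨E', hk, hsub, hE', hall⟩ := h.exists_of_orientAll (href o' ho') hs' hne
    (sound_addArc (h.self v) hE) fun u hu w hw hwv hm =>
      hasArc_addArc.2 (Or.inl (hcomp u hu w (hmem w hw hwv) hm))
  have hcomp' : ∀ u ∈ o', ∀ w ∈ o', M u w → hasArc E' u w = true := fun u hu w hw hm => by
    by_cases huv : u = v <;> by_cases hwv : w = v
    · exact hsub _ _ (hasArc_addArc.2 (Or.inr ⟨huv, hwv⟩))
    · subst huv
      exact (hall w (hmem w hw hwv)).2 hm
    · subst hwv
      exact (hall u (hmem u hu huv)).1 hm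
    · exact hsub _ _ (hasArc_addArc.2 (Or.inl (hcomp u (hmem u hu huv) w (hmem w hw hwv) hm)))
  rw [h.rowBad_eq_false hs' fun w hw => ⟨hE' v w, hcomp' v (hperm.mem_iff.2 (by simp)) w hw⟩,
    Bool.false_or] at hk
  refine ⟨o', E', hk, ⟨?_, hs', hE', hcomp'⟩, hperm⟩
  rw [insertAfter, List.mem_cons, List.mem_map] at ho'
  rcases ho' with rfl | ⟨t, -, rfl⟩ <;> exact ⟨_, rfl⟩

theorem refute_eq_false (h : IsModel q M) {vs : List (Fin 8)} (hd : Describes q M o E)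
    (hvs : vs.Nodup) (hdisj : ∀ v ∈ vs, v ∉ o) : refute vs o E = false := by
  induction vs generalizing o E with
  | nil => rfl
  | cons v vs ih =>
    rw [List.nodup_cons] at hvs
    rw [← Bool.not_eq_true]
    intro href
    obtain ⟨o', E', href', hd', hperm⟩ := h.exists_of_refute_cons href hd (hdisj v (by simp))
    rw [ih hd' hvs.2 fun w hw hwo => ?_] at href'
    · exact Bool.false_ne_true href'
    · rcases List.mem_cons.1 (hperm.mem_iff.1 hwo) with rfl | hwo
      · exact hvs.1 hw
      · exact hdisj w (by simp [hw]) hwo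

theorem elim (h : IsModel q M) : False := by
  have hone : ∀ u w : Fin 8, hasArc 1 u w = true → u = 0 ∧ w = 0 := by decide
  refine Bool.false_ne_true ((h.refute_eq_false (o := [0]) (E := 1)
    ⟨⟨[], rfl⟩, by simp, fun u w huw => ?_, ?_⟩ (by decide) (by decide)).symm.trans refute_eq_true)
  · obtain ⟨rfl, rfl⟩ := hone u w huw
    exact h.self 0
  · simp only [List.mem_singleton]
    rintro u rfl w rfl -
    rfl

end IsModel

theorem fract_add_fract_cases (x c : ℝ) (hx : 0 ≤ x) (hx1 : x < 1) (hc : 0 ≤ c) (hc1 : c < 1) :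
    (x + c < 1 ∧ Int.fract (x + c) = x + c) ∨ (1 ≤ x + c ∧ Int.fract (x + c) = x + c - 1) := by
  rcases lt_or_ge (x + c) 1 with h | h
  · exact Or.inl ⟨h, Int.fract_eq_self.2 ⟨by linarith, h⟩⟩
  · refine Or.inr ⟨h, ?_⟩
    rw [← Int.fract_sub_one]
    exact Int.fract_eq_self.2 ⟨by linarith, by linarith⟩

theorem arcMem_iff_fract_base (a ℓ b x : ℝ) :
    arcMem a ℓ x ↔ Int.fract (Int.fract (x - b) + Int.fract (b - a)) ≤ ℓ := by
  have : x - a = Int.fract (x - b) + Int.fract (b - a) + ((⌊x - b⌋ + ⌊b - a⌋ : ℤ) : ℝ) := by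
    push_cast
    linarith [Int.fract_add_floor (x - b), Int.fract_add_floor (b - a)]
  rw [arcMem, this, Int.fract_add_intCast]

/-- The trace of an arc on points in circular order does not alternate. -/
theorem arcMem_not_alternating (a ℓ b : ℝ) {w x y z : ℝ}
    (hwx : Int.fract (w - b) < Int.fract (x - b)) (hxy : Int.fract (x - b) < Int.fract (y - b))
    (hyz : Int.fract (y - b) < Int.fract (z - b)) :
    ¬ (arcMem a ℓ w ∧ ¬ arcMem a ℓ x ∧ arcMem a ℓ y ∧ ¬ arcMem a ℓ z) ∧
      ¬ (¬ arcMem a ℓ w ∧ arcMem a ℓ x ∧ ¬ arcMem a ℓ y ∧ arcMem a ℓ z) := by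
  simp only [arcMem_iff_fract_base a ℓ b]
  have cases := fun t : ℝ => fract_add_fract_cases (Int.fract (t - b)) (Int.fract (b - a))
    (Int.fract_nonneg _) (Int.fract_lt_one _) (Int.fract_nonneg _) (Int.fract_lt_one _)
  have hw0 := Int.fract_nonneg (w - b)
  have hz1 := Int.fract_lt_one (z - b)
  constructor <;> rintro ⟨h1, h2, h3, h4⟩ <;>
    rcases cases w with ⟨_, ew⟩ | ⟨_, ew⟩ <;> rcases cases x with ⟨_, ex⟩ | ⟨_, ex⟩ <;>
    rcases cases y with ⟨_, ey⟩ | ⟨_, ey⟩ <;> rcases cases z with ⟨_, ez⟩ | ⟨_, ez⟩ <;>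
    rw [ew] at h1 <;> rw [ex] at h2 <;> rw [ey] at h3 <;> rw [ez] at h4 <;> linarith

end CatchDigraph


/-- the underlying graph of an oriented circular-arc catch
digraph does not contain the complement of C_8 as an induced subgraph. -/
theorem stmt_6 {V : Type*} (E : V → V → Prop)
    (hirr : ∀ v, ¬ E v v) (horient : Oriented E)
    (hcatch : IsCACatchDigraph E) :
    ¬ ∃ f : Fin 8 → V, Function.Injective f ∧
        ∀ i j : Fin 8, i ≠ j →
          ((E (f i) (f j) ∨ E (f j) (f i)) ↔
            ¬ (j.val = (i.val + 1) % 8 ∨ i.val = (j.val + 1) % 8)) := by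
  rintro ⟨f, hf, hadj⟩
  obtain ⟨a, ℓ, p, hself, hE⟩ := hcatch
  have hM : ∀ u v, u ≠ v → (E (f u) (f v) ↔ arcMem (a (f u)) (ℓ (f u)) (p (f v))) :=
    fun u v huv => by simp [hE, hf.ne huv]
  let q : Fin 8 → ℝ := fun v => Int.fract (p (f v) - p (f 0))
  have hinj : Function.Injective q := fun u v huv => by
    by_contra hne
    have hsame : ∀ w, arcMem (a (f w)) (ℓ (f w)) (p (f u)) ↔
        arcMem (a (f w)) (ℓ (f w)) (p (f v)) := fun w => by
      rw [CatchDigraph.arcMem_iff_fract_base _ _ (p (f 0)) (p (f u)),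
        CatchDigraph.arcMem_iff_fract_base _ _ (p (f 0)) (p (f v)), show
        Int.fract (p (f u) - p (f 0)) = Int.fract (p (f v) - p (f 0)) from huv]
    exact horient (f u) (f v) ((hM u v hne).2 ((hsame u).1 (hself _)))
      ((hM v u (Ne.symm hne)).2 ((hsame v).2 (hself _)))
  have hmodel : CatchDigraph.IsModel q
      fun u v => arcMem (a (f u)) (ℓ (f u)) (p (f v)) := by
    refine ⟨fun v hv => ?_, hinj, fun u => hself (f u), fun u v huv hc => ?_,
      fun u v huv hc => ?_, fun u w x y z => CatchDigraph.arcMem_not_alternating _ _ (p (f 0))⟩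
    · refine lt_of_le_of_ne ?_ (hinj.ne hv.symm)
      simp [q]
    · rw [← hM u v huv, ← hM v u huv.symm, ← not_or, hadj u v huv]
      exact not_not.2 (CatchDigraph.cycleAdj_iff.1 hc)
    · rw [← hM u v huv, ← hM v u huv.symm]
      have := (hadj u v huv).2 (mt CatchDigraph.cycleAdj_iff.2 hc)
      have := horient (f u) (f v)
      tauto
  exact hmodel.elim
end

section
/- Let B be a 0/1 matrix satisfying circular ones property along both rows and columns, in which the set difference of the circular one-blocks of any two rows is a circular interval and, for every full row r and nontrivial rows s,t, the set r−s−t is a circular interval. Then the rows of B can be permuted to achieve a monotone circular ordering: the sequences (λ_i) and (μ_i) of (suitably normalized) left and right endpoints of the circular one-blocks of the rows are both non-decreasing. -/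
/-- Some translate of `x` by a multiple of `n` lies in `[l, u]`. -/
def LiftMem (n l u x : ℤ) : Prop := ∃ t : ℤ, l ≤ x + t * n ∧ x + t * n ≤ u

theorem LiftMem.of_mem {n l u x : ℤ} (h₁ : l ≤ x) (h₂ : x ≤ u) : LiftMem n l u x :=
  ⟨0, by omega, by omega⟩

theorem not_liftMem {n l u x : ℤ} (hn : 0 < n) (h₁ : x < l) (h₂ : u < x + n) :
    ¬ LiftMem n l u x := by
  rintro ⟨t, ht₁, ht₂⟩
  have h0 : 0 < t := by
    by_contra! h
    nlinarith
  nlinarith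

theorem liftMem_add {n l u x : ℤ} : LiftMem n l u (x + n) ↔ LiftMem n l u x := by
  constructor
  · rintro ⟨t, h₁, h₂⟩
    exact ⟨t + 1, by linarith, by linarith⟩
  · rintro ⟨t, h₁, h₂⟩
    exact ⟨t - 1, by linarith, by linarith⟩

theorem liftMem_add_mul {n l u x : ℤ} (s : ℤ) :
    LiftMem n l u (x + s * n) ↔ LiftMem n l u x := by
  constructor
  · rintro ⟨t, h₁, h₂⟩
    exact ⟨t + s, by linarith, by linarith⟩
  · rintro ⟨t, h₁, h₂⟩
    exact ⟨t - s, by linarith, by linarith⟩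

theorem liftMem_shift {n l u x : ℤ} (s : ℤ) :
    LiftMem n (l + s * n) (u + s * n) x ↔ LiftMem n l u x := by
  constructor
  · rintro ⟨t, h₁, h₂⟩
    exact ⟨t - s, by linarith, by linarith⟩
  · rintro ⟨t, h₁, h₂⟩
    exact ⟨t + s, by linarith, by linarith⟩

theorem liftMem_shift_one {n l u x : ℤ} :
    LiftMem n (l + n) (u + n) x ↔ LiftMem n l u x := by
  simpa using liftMem_shift (n := n) (l := l) (u := u) (x := x) 1

theorem not_liftMem_of_lt {n l u x : ℤ} (hn : 0 < n) (h₁ : u < x) (h₂ : x < l + n) :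
    ¬ LiftMem n l u x := by
  rw [← liftMem_shift_one]
  exact not_liftMem hn h₂ (by omega)

/-- The lifts to a line of the points of an arc do not alternate with the other points. -/
theorem LiftMem.not_alternating {n l u x y z w : ℤ} (hn : 0 < n) (hxy : x < y) (hyz : y < z)
    (hzw : z < w) (hwx : w < x + n) (hx : LiftMem n l u x) (hy : ¬ LiftMem n l u y)
    (hz : LiftMem n l u z) (hw : ¬ LiftMem n l u w) : False := by
  obtain ⟨t, ht₁, ht₂⟩ := hx
  obtain ⟨s, hs₁, hs₂⟩ := hz
  have h₁ : u < y + t * n := by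
    by_contra! h
    exact hy ⟨t, by omega, h⟩
  have h₂ : u < w + s * n := by
    by_contra! h
    exact hw ⟨s, by omega, h⟩
  have hst : s < t := lt_of_mul_lt_mul_right (by omega : s * n < t * n) hn.le
  nlinarith

/-- A cyclic family of arcs such that any two neighbours jointly miss a point on their outer
side and no two arcs jointly have a disconnected complement: the arcs missing a point cannot
all be intervals for a linear preorder. -/
theorem no_linear_preorder_of_cyclic_arcs {n k N : ℤ} (hn : 0 < n) (hk : 0 < k)
    {L M σ : ℤ → ℤ} (hL : Monotone L) (hM : Monotone M)
    (hLk : ∀ i, L (i + k) = L i + n) (hMk : ∀ i, M (i + k) = M i + n)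
    (hLM : ∀ i, L i ≤ M i) (hgap : ∀ i, M (i + 1) + 1 < L i + n)
    (hconn : ∀ i j x y, y < L i → M i < x → x < L j → M j < y + n → False)
    (hσ₀ : ∀ i, 0 ≤ σ i) (hσN : ∀ i, σ i ≤ N)
    (hσk : ∀ i (s : ℤ), σ (i + s * k) = σ i)
    (hint : ∀ x i₁ i₂ i₃, σ i₁ ≤ σ i₂ → σ i₂ ≤ σ i₃ → ¬ LiftMem n (L i₁) (M i₁) x →
      ¬ LiftMem n (L i₃) (M i₃) x → ¬ LiftMem n (L i₂) (M i₂) x) : False := by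
  have htouch : ∀ i, L (i + 1) ≤ M i + 1 := by
    intro i
    by_contra! h
    have := hgap i
    exact hconn i (i + 1) (M i + 1) (L i - 1) (by omega) (by omega) h (by omega)
  have hMn : ∀ i, M i + 1 < L i + n := fun i => by
    have := hM (by omega : i ≤ i + 1)
    have := hgap i
    omega
  obtain ⟨f, hf⟩ : ∃ f, ∀ i, σ f ≤ σ i := by
    obtain ⟨v, ⟨f, rfl⟩, hv⟩ := Int.exists_least_of_bdd (P := fun v => ∃ i, σ i = v)
      ⟨0, by rintro _ ⟨i, rfl⟩; exact hσ₀ i⟩ ⟨_, 0, rfl⟩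
    exact ⟨f, fun i => hv _ ⟨i, rfl⟩⟩
  have hf₁ : ¬ LiftMem n (L f) (M f) (L f - 1) :=
    not_liftMem hn (by omega) (by have := hMn f; omega)
  obtain ⟨x', e', hfx', hex', hmax'⟩ : ∃ x e, ¬ LiftMem n (L f) (M f) x ∧
      ¬ LiftMem n (L e) (M e) x ∧ ∀ y i, ¬ LiftMem n (L f) (M f) y →
      ¬ LiftMem n (L i) (M i) y → σ i ≤ σ e := by
    obtain ⟨v, ⟨x, e, h₁, h₂, rfl⟩, hv⟩ := Int.exists_greatest_of_bdd
      (P := fun v => ∃ x e, ¬ LiftMem n (L f) (M f) x ∧ ¬ LiftMem n (L e) (M e) x ∧ σ e = v)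
      ⟨N, by rintro _ ⟨x, e, _, _, rfl⟩; exact hσN e⟩ ⟨_, _, f, hf₁, hf₁, rfl⟩
    exact ⟨x, e, h₁, h₂, fun y i h₃ h₄ => hv _ ⟨y, i, h₃, h₄, rfl⟩⟩
  -- normalise the lift of the column and of the index
  obtain ⟨x, hfx, hxM, hxL, hex', hmax⟩ : ∃ x, ¬ LiftMem n (L f) (M f) x ∧ M f < x ∧
      x < L f + n ∧ ¬ LiftMem n (L e') (M e') x ∧ ∀ y i, ¬ LiftMem n (L f) (M f) y →
      ¬ LiftMem n (L i) (M i) y → σ i ≤ σ e' := by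
    have hdiv := Int.emod_add_mul_ediv (x' - L f) n
    have h₁ := Int.emod_nonneg (x' - L f) hn.ne'
    have h₂ := Int.emod_lt_of_pos (x' - L f) hn
    have hx : x' + (-((x' - L f) / n)) * n = L f + (x' - L f) % n := by linarith
    have h₃ : ¬ LiftMem n (L f) (M f) (L f + (x' - L f) % n) := by
      rw [← hx, liftMem_add_mul]; exact hfx'
    refine ⟨L f + (x' - L f) % n, h₃, ?_, by omega, ?_, hmax'⟩
    · by_contra! h
      exact h₃ (LiftMem.of_mem (by omega) h)
    · rw [← hx, liftMem_add_mul]; exact hex'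
  obtain ⟨e, hfe, hek, hex, hσe⟩ : ∃ e, f ≤ e ∧ e < f + k ∧ ¬ LiftMem n (L e) (M e) x ∧
      σ e = σ e' := by
    have hdiv := Int.emod_add_mul_ediv (e' - f) k
    have h₁ := Int.emod_nonneg (e' - f) hk.ne'
    have h₂ := Int.emod_lt_of_pos (e' - f) hk
    have he : e' = (f + (e' - f) % k) + (e' - f) / k * k := by linarith
    have hs : σ (f + (e' - f) % k) = σ e' := by
      have h := hσk (f + (e' - f) % k) ((e' - f) / k)
      rw [← he] at h
      exact h.symm
    exact ⟨_, by omega, by omega, hint x _ _ _ hs.ge hs.le hex' hex', hs⟩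
  rw [← hσe] at hmax
  have hmiss : ∀ y i, ¬ LiftMem n (L f) (M f) y → ¬ LiftMem n (L i) (M i) y →
      ¬ LiftMem n (L i) (M i) x := fun y i h₁ h₂ =>
    hint x f i e (hf i) (hmax y i h₁ h₂) hfx hex
  have hlt : ∀ i, LiftMem n (L i) (M i) x → σ e < σ i := by
    intro i hi
    by_contra! h
    exact hint x f i e (hf i) h hfx hex hi
  have hpair : ∀ i, ∃ y, ¬ LiftMem n (L i) (M i) y ∧ ¬ LiftMem n (L (i + 1)) (M (i + 1)) y := by
    intro i
    have h₁ := hgap i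
    have h₂ := hMn i
    have h₃ := hL (by omega : i ≤ i + 1)
    exact ⟨L i - 1, not_liftMem hn (by omega) (by omega), not_liftMem hn (by omega) (by omega)⟩
  have hnext : M (f + 1) < x := by
    obtain ⟨y, h₁, h₂⟩ := hpair f
    have := hmiss y _ h₁ h₂
    have h₃ := htouch f
    by_contra! h
    exact this (LiftMem.of_mem (by omega) h)
  have hprev : x < L (f + k - 1) := by
    obtain ⟨y, h₁, h₂⟩ := hpair (f + k - 1)
    rw [show f + k - 1 + 1 = f + k by ring, hLk, hMk, liftMem_shift_one] at h₂
    have := hmiss y _ h₂ h₁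
    have h₃ := htouch (f + k - 1)
    rw [show f + k - 1 + 1 = f + k by ring, hLk] at h₃
    by_contra! h
    exact this (LiftMem.of_mem h (by omega))
  -- the first arc reaching `x` and the last one starting before it
  obtain ⟨α, hα, hαmin⟩ := Int.exists_least_of_bdd (P := fun i => x ≤ M i)
    ⟨f, fun i hi => by
      by_contra! h
      have := hM h.le
      omega⟩ ⟨f + k - 1, by have := hLM (f + k - 1); omega⟩
  obtain ⟨β, hβ, hβmax⟩ := Int.exists_greatest_of_bdd (P := fun i => L i ≤ x)
    ⟨f + k, fun i hi => by
      by_contra! h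
      have := hL h.le
      rw [hLk] at this
      omega⟩ ⟨f, by have := hLM f; omega⟩
  have hα₁ : M (α - 1) < x := by
    by_contra! h
    have := hαmin _ h
    omega
  have hβ₁ : x < L (β + 1) := by
    by_contra! h
    have := hβmax _ h
    omega
  have hαf : f ≤ α - 1 := by
    by_contra! h
    have := hM (by omega : α ≤ f)
    omega
  have hβk : β + 1 ≤ f + k := by
    by_contra! h
    have := hL (by omega : f + k ≤ β)
    rw [hLk] at this
    omega
  have hαx : LiftMem n (L α) (M α) x :=
    LiftMem.of_mem (by have := htouch (α - 1); rw [sub_add_cancel] at this; omega) hα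
  have hβx : LiftMem n (L β) (M β) x :=
    LiftMem.of_mem hβ (by have := htouch β; omega)
  have hbounds : ∀ i, f ≤ i → i ≤ f + k → M f ≤ M i ∧ L i ≤ L f + n := fun i h₁ h₂ =>
    ⟨hM h₁, hLk f ▸ hL h₂⟩
  have hlift : ∀ i y, f ≤ i → i ≤ f + k → ¬ LiftMem n (L i) (M i) y → L f ≤ y → y ≤ M f →
      y < L i ∧ M i < y + n := by
    intro i y h₁ h₂ h₃ h₄ h₅
    have := hbounds i h₁ h₂
    constructor
    · by_contra! h
      exact h₃ (LiftMem.of_mem h (by omega))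
    · by_contra! h
      exact h₃ (liftMem_add.1 (LiftMem.of_mem (by omega) h))
  have hcol : ∀ i, (¬ LiftMem n (L i) (M i) x ∧ LiftMem n (L (i + 1)) (M (i + 1)) x ∨
      LiftMem n (L i) (M i) x ∧ ¬ LiftMem n (L (i + 1)) (M (i + 1)) x) →
      ∃ y, L f ≤ y ∧ y ≤ M f ∧ ¬ LiftMem n (L i) (M i) y ∧
        ¬ LiftMem n (L (i + 1)) (M (i + 1)) y ∧ ¬ LiftMem n (L e) (M e) y := by
    intro i hi
    obtain ⟨y, h₁, h₂⟩ := hpair i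
    have hey : ¬ LiftMem n (L e) (M e) y := by
      rcases hi with ⟨h₃, h₄⟩ | ⟨h₃, h₄⟩
      · exact hint y i e (i + 1) (hmax x i hfx h₃) (hlt _ h₄).le h₁ h₂
      · exact hint y (i + 1) e i (hmax x _ hfx h₄) (hlt _ h₃).le h₂ h₁
    have hfy : LiftMem n (L f) (M f) y := by
      by_contra h
      rcases hi with ⟨h₃, h₄⟩ | ⟨h₃, h₄⟩
      · exact hmiss y _ h h₂ h₄
      · exact hmiss y _ h h₁ h₃
    obtain ⟨t, ht₁, ht₂⟩ := hfy
    refine ⟨y + t * n, ht₁, ht₂, ?_, ?_, ?_⟩ <;> rw [liftMem_add_mul] <;> assumption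
  have hαmiss : ¬ LiftMem n (L (α - 1)) (M (α - 1)) x := by
    have h₁ := hL hαf
    have h₂ := hLM (α - 1)
    rw [← liftMem_shift_one]
    exact not_liftMem hn (by omega) (by omega)
  have hβmiss : ¬ LiftMem n (L (β + 1)) (M (β + 1)) x := by
    have h₁ := hM hβk
    rw [hMk] at h₁
    exact not_liftMem hn hβ₁ (by omega)
  rcases lt_or_ge (M e) x with h | h
  · obtain ⟨y, h₁, h₂, -, h₃, h₄⟩ := hcol β (Or.inr ⟨hβx, hβmiss⟩)
    have hβf : f ≤ β + 1 := by
      have := hβmax f (by have := hLM f; omega)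
      omega
    exact hconn e (β + 1) x y (hlift e y hfe hek.le h₄ h₁ h₂).1 h hβ₁
      (hlift _ y hβf hβk h₃ h₁ h₂).2
  · have he : x < L e := by
      by_contra! h'
      exact hex (LiftMem.of_mem h' h)
    obtain ⟨y, h₁, h₂, h₃, -, h₄⟩ := hcol (α - 1)
      (Or.inl ⟨hαmiss, by rwa [sub_add_cancel]⟩)
    have hαk : α - 1 ≤ f + k := by
      have := hαmin (f + k - 1) (by have := hLM (f + k - 1); omega)
      omega
    exact hconn (α - 1) e x y (hlift _ y hαf hαk h₃ h₁ h₂).1 hα₁ he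
      (hlift e y hfe hek.le h₄ h₁ h₂).2

theorem Fin.sub_le_sub_iff_mem_arc {n : ℕ} (a b i : Fin n) :
    i - a ≤ b - a ↔ (a ≤ b ∧ a ≤ i ∧ i ≤ b) ∨ (b < a ∧ (a ≤ i ∨ i ≤ b)) := by
  have hsub : ∀ c : Fin n, (c - a).val = if a ≤ c then c.val - a.val else n + c.val - a.val := by
    intro c
    split_ifs with h
    · exact Fin.coe_sub_iff_le.2 h
    · exact Fin.coe_sub_iff_lt.2 (not_le.1 h)
  rw [Fin.le_def, hsub, hsub]
  simp only [Fin.le_def, Fin.lt_def]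
  split_ifs <;> omega

/-- The point of the circle `Fin n` below the integer `x`. -/
def circPoint {n : ℕ} (hn : 0 < n) (x : ℤ) : Fin n :=
  ⟨(x % n).toNat, by
    have := Int.emod_nonneg x (by omega : (n : ℤ) ≠ 0)
    have := Int.emod_lt_of_pos x (by omega : (0 : ℤ) < n)
    omega⟩

theorem circPoint_val {n : ℕ} (hn : 0 < n) (x : ℤ) : ((circPoint hn x).val : ℤ) = x % n :=
  Int.toNat_of_nonneg (Int.emod_nonneg x (by omega))

theorem circPoint_coe {n : ℕ} (hn : 0 < n) (j : Fin n) : circPoint hn (j.val : ℤ) = j := by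
  apply Fin.ext
  have h := circPoint_val hn j.val
  rw [Int.emod_eq_of_lt (by omega) (by omega)] at h
  omega

theorem liftMem_circPoint {n : ℕ} (hn : 0 < n) (l u x : ℤ) :
    LiftMem n l u (circPoint hn x).val ↔ LiftMem n l u x := by
  rw [circPoint_val, ← liftMem_add_mul (x / n)]
  have := Int.emod_add_mul_ediv x n
  rw [show x % n + x / n * n = x by linarith]

theorem liftMem_iff_of_bounds {n l u x : ℤ} (hl : 0 ≤ l) (hln : l < n) (hu : u < l + n)
    (hx : 0 ≤ x) (hxn : x < n) : LiftMem n l u x ↔ (l ≤ x ∧ x ≤ u) ∨ x + n ≤ u := by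
  constructor
  · rintro ⟨t, h₁, h₂⟩
    have h₃ : -1 < t := by
      by_contra! h
      nlinarith
    have h₄ : t < 2 := by
      by_contra! h
      nlinarith
    interval_cases t <;> omega
  · rintro (⟨h₁, h₂⟩ | h)
    · exact LiftMem.of_mem h₁ h₂
    · exact liftMem_add.1 (LiftMem.of_mem (by omega) h)

theorem CircBlock.exists_endpoints {n : ℕ} (hn : 0 < n) {S : Set (Fin n)} (hS : CircBlock S)
    (hne : S.Nonempty) : ∃ l u : ℤ, 0 ≤ l ∧ l < n ∧ l ≤ u ∧ u < l + n ∧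
      ∀ x : ℤ, circPoint hn x ∈ S ↔ LiftMem n l u x := by
  rcases hS with rfl | ⟨a, b, rfl⟩
  · exact absurd hne Set.not_nonempty_empty
  refine ⟨a, if a ≤ b then b else b + n, by omega, by omega, ?_, ?_, fun x => ?_⟩
  · split_ifs with h
    · exact_mod_cast h
    · omega
  · split_ifs with h
    · omega
    · have := not_le.1 h
      rw [Fin.lt_def] at this
      omega
  · rw [← liftMem_circPoint hn, liftMem_iff_of_bounds (by omega) (by omega) _ (by omega) (by omega),
      Set.mem_ofPred_eq, Fin.sub_le_sub_iff_mem_arc]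
    · simp only [Fin.le_def, Fin.lt_def]
      split_ifs <;> omega
    · split_ifs with h
      · omega
      · rw [Fin.le_def] at h
        omega

theorem CircBlock.not_alternating {n : ℕ} (hn : 0 < n) {S : Set (Fin n)} (hS : CircBlock S)
    {x y z w : ℤ} (hxy : x < y) (hyz : y < z) (hzw : z < w) (hwx : w < x + n)
    (hx : circPoint hn x ∈ S) (hy : circPoint hn y ∉ S) (hz : circPoint hn z ∈ S)
    (hw : circPoint hn w ∉ S) : False := by
  obtain ⟨l, u, -, -, -, -, h⟩ := hS.exists_endpoints hn ⟨_, hx⟩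
  rw [h] at hx hy hz hw
  exact LiftMem.not_alternating (by omega) hxy hyz hzw hwx hx hy hz hw

theorem circBlock_of_not_alternating {m : ℕ} {S : Set (Fin m)}
    (h₁ : ∀ i j k l, i < j → j < k → k < l → i ∈ S → j ∉ S → k ∈ S → l ∉ S → False)
    (h₂ : ∀ i j k l, i < j → j < k → k < l → i ∉ S → j ∈ S → k ∉ S → l ∈ S → False) :
    CircBlock S := by
  classical
  rcases S.eq_empty_or_nonempty with hS | hS
  · exact Or.inl hS
  right
  simp only [Fin.sub_le_sub_iff_mem_arc]
  have hm : 0 < m := (Fin.pos hS.choose)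
  set z : Fin m := ⟨0, hm⟩ with hz
  have hz_le : ∀ i : Fin m, z ≤ i := fun i => Nat.zero_le _
  have key : ∀ T : Set (Fin m), T.Nonempty → z ∉ T →
      (∀ i j k l, i < j → j < k → k < l → i ∉ T → j ∈ T → k ∉ T → l ∈ T → False) →
      ∃ c d, c ≤ d ∧ z < c ∧ T = Set.Icc c d := by
    intro T hT hzT hal
    obtain ⟨c, hcT, hc⟩ := Set.exists_min_image T id T.toFinite hT
    obtain ⟨d, hdT, hd⟩ := Set.exists_max_image T id T.toFinite hT
    have hzc : z < c := lt_of_le_of_ne (hz_le c) fun h => hzT (h ▸ hcT)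
    refine ⟨c, d, hc d hdT, hzc, Set.ext fun i => ⟨fun hi => ⟨hc i hi, hd i hi⟩, ?_⟩⟩
    rintro ⟨hci, hid⟩
    by_contra hi
    exact hal z c i d hzc (lt_of_le_of_ne hci fun h => hi (h ▸ hcT))
      (lt_of_le_of_ne hid fun h => hi (h ▸ hdT)) hzT hcT hi hdT
  by_cases hzS : z ∈ S
  · rcases Sᶜ.eq_empty_or_nonempty with hc | hc
    · refine ⟨z, ⟨m - 1, by omega⟩, ?_⟩
      rw [Set.compl_empty_iff] at hc
      ext i
      simp only [hc, Set.mem_univ, Set.mem_ofPred_eq, Fin.le_def, hz, true_iff]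
      omega
    · obtain ⟨c, d, hcd, hzc, hT⟩ := key Sᶜ hc (by simpa using hzS) fun i j k l hij hjk hkl a b e f =>
        h₁ i j k l hij hjk hkl (by simpa using a) b (by simpa using e) f
      have hS' : ∀ i, i ∈ S ↔ i < c ∨ d < i := by
        intro i
        have := Set.ext_iff.1 hT i
        rw [Set.mem_compl_iff, Set.mem_Icc] at this
        rw [← not_iff_not, this, not_or, not_lt, not_lt]
      simp only [Fin.le_def, Fin.lt_def, hz] at hcd hzc hS' ⊢
      by_cases hd : d.val + 1 < m
      · refine ⟨⟨d + 1, hd⟩, ⟨c - 1, by omega⟩, ?_⟩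
        ext i
        rw [hS', Set.mem_ofPred_eq]
        simp only
        omega
      · refine ⟨z, ⟨c - 1, by omega⟩, ?_⟩
        ext i
        rw [hS', Set.mem_ofPred_eq]
        simp only [hz]
        omega
  · obtain ⟨c, d, hcd, -, hT⟩ := key S hS hzS h₂
    refine ⟨c, d, ?_⟩
    ext i
    simp [hT, hcd, not_lt.2 hcd]

theorem circPoint_add_mul {n : ℕ} (hn : 0 < n) (x s : ℤ) :
    circPoint hn (x + s * n) = circPoint hn x := by
  apply Fin.ext
  have h₁ := circPoint_val hn (x + s * n)
  have h₂ := circPoint_val hn x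
  rw [Int.add_mul_emod_self_right] at h₁
  omega

theorem exists_perm_monotone_monotone {k : ℕ} (f g : Fin k → ℤ)
    (hchain : ∀ i j, (f i ≤ f j ∧ g i ≤ g j) ∨ (f j ≤ f i ∧ g j ≤ g i)) :
    ∃ π : Equiv.Perm (Fin k), Monotone (f ∘ π) ∧ Monotone (g ∘ π) := by
  have hmono : ∀ i j, i ≤ j → f (Tuple.sort (f + g) i) ≤ f (Tuple.sort (f + g) j) ∧
      g (Tuple.sort (f + g) i) ≤ g (Tuple.sort (f + g) j) := by
    intro i j hij
    have h := Tuple.monotone_sort (f + g) hij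
    simp only [Function.comp_apply, Pi.add_apply] at h
    have := hchain (Tuple.sort (f + g) i) (Tuple.sort (f + g) j)
    omega
  exact ⟨Tuple.sort (f + g), fun i j h => (hmono i j h).1, fun i j h => (hmono i j h).2⟩

theorem exists_sorted_periodic_enumeration {m : ℕ} {P : Fin m → Prop} (hP : ∃ i, P i)
    (a b : Fin m → ℤ) (hchain : ∀ r s, P r → P s →
      (a r ≤ a s ∧ b r ≤ b s) ∨ (a s ≤ a r ∧ b s ≤ b r)) :
    ∃ (k : ℤ) (e : ℤ → Fin m), 0 < k ∧ (∀ i, P (e i)) ∧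
      (∀ s, P s → ∃ i, 0 ≤ i ∧ i < k ∧ e i = s) ∧ (∀ i s, e (i + s * k) = e i) ∧
      ∀ i j, 0 ≤ i → i ≤ j → j < k → a (e i) ≤ a (e j) ∧ b (e i) ≤ b (e j) := by
  classical
  set K := Fintype.card {i // P i}
  have hK : 0 < K := Fintype.card_pos_iff.2 ⟨⟨_, hP.choose_spec⟩⟩
  let e₀ : Fin K ≃ {i // P i} := (Fintype.equivFin _).symm
  obtain ⟨π, hπ₁, hπ₂⟩ := exists_perm_monotone_monotone (fun i => a (e₀ i)) (fun i => b (e₀ i))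
    fun i j => hchain _ _ (e₀ i).2 (e₀ j).2
  refine ⟨K, fun i => e₀ (π (circPoint hK i)), by omega, fun i => (e₀ _).2, fun s hs => ?_,
    fun i s => ?_, fun i j hi hij hj => ?_⟩
  · refine ⟨(π.symm (e₀.symm ⟨s, hs⟩)).val, by omega, by omega, ?_⟩
    simp [circPoint_coe]
  · simp only [circPoint_add_mul]
  · have hle : circPoint hK i ≤ circPoint hK j := by
      have h₁ := circPoint_val hK i
      have h₂ := circPoint_val hK j
      rw [Int.emod_eq_of_lt (by omega) (by omega)] at h₁ h₂
      rw [Fin.le_def]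
      omega
    exact ⟨hπ₁ hle, hπ₂ hle⟩

theorem exists_eq_add_mul {k : ℤ} (hk : 0 < k) (i : ℤ) :
    ∃ r q, 0 ≤ r ∧ r < k ∧ i = r + q * k :=
  ⟨i % k, i / k, Int.emod_nonneg _ hk.ne', Int.emod_lt_of_pos _ hk, by
    linarith [Int.emod_add_mul_ediv i k]⟩

theorem add_mul_ediv_of_bounds {r k : ℤ} (q : ℤ) (hr : 0 ≤ r) (hrk : r < k) :
    (r + q * k) / k = q := by
  rw [Int.add_mul_ediv_right _ _ (by omega), Int.ediv_eq_zero_of_lt hr hrk, zero_add]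

theorem monotone_add_ediv_mul {k n : ℤ} (hk : 0 < k) {g : ℤ → ℤ}
    (hper : ∀ i s, g (i + s * k) = g i) (hmono : ∀ i j, 0 ≤ i → i ≤ j → j < k → g i ≤ g j)
    (hwrap : g (k - 1) ≤ g 0 + n) : Monotone fun i => g i + i / k * n := by
  refine monotone_int_of_le_succ fun i => ?_
  obtain ⟨r, q, hr, hrk, rfl⟩ := exists_eq_add_mul hk i
  rcases lt_or_ge (r + 1) k with h | h
  · rw [show r + q * k + 1 = (r + 1) + q * k by ring, hper, hper,
      add_mul_ediv_of_bounds q hr hrk, add_mul_ediv_of_bounds q (by omega) h]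
    have := hmono r (r + 1) hr (by omega) h
    omega
  · obtain rfl : r = k - 1 := by omega
    rw [show k - 1 + q * k + 1 = 0 + (q + 1) * k by ring, hper, hper,
      add_mul_ediv_of_bounds q hr hrk, add_mul_ediv_of_bounds (q + 1) le_rfl hk]
    linarith

/-- Endpoints for the full rows compatible with those of the other rows exist: at every
candidate, failure yields a family excluded by `no_linear_preorder_of_cyclic_arcs`. -/
theorem exists_full_row_endpoint {m n : ℕ} (hn : 0 < n) {B : Fin m → Fin n → Prop}
    {a b : Fin m → ℤ} (ha₀ : ∀ i, 0 ≤ a i) (han : ∀ i, a i < n) (hab : ∀ i, a i ≤ b i)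
    (hB : ∀ i x, B i (circPoint hn x) ↔ LiftMem n (a i) (b i) x)
    (hcol : ∀ j, CircBlock {i | B i j})
    (hchain : ∀ r s, b r + 1 < a r + n → b s + 1 < a s + n →
      (a r ≤ a s ∧ b r ≤ b s) ∨ (a s ≤ a r ∧ b s ≤ b r))
    (hwrap : ∀ r s, b r + 1 < a r + n → b r ≤ b s + n)
    (hconn : ∀ r s, b r + 1 < a r + n → b s + 1 < a s + n → ∀ p q x y : ℤ,
      y < a r + p * n → b r + p * n < x → x < a s + q * n → b s + q * n < y + n → False)
    (r₀ : Fin m) (hr₀ : ∀ j, B r₀ j) :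
    ∃ L : ℤ, 0 ≤ L ∧ L < n ∧
      (∀ s, b s + 1 < a s + n → a s ≤ L ∨ L + n ≤ b s + 1) ∧
      ∀ i l, b i + 1 < a i + n → b l + 1 < a l + n → b i + 1 < a l → a l ≤ L → False := by
  by_contra hbad
  have hmax : ∃ i l, b i + 1 < a i + n ∧ b l + 1 < a l + n ∧ b i + 1 < a l := by
    by_contra! h
    exact hbad ⟨n - 1, by omega, by omega, fun s _ => Or.inl (by have := han s; omega),
      fun i l hi hl hil _ => not_le.2 hil (h i l hi hl)⟩
  obtain ⟨i₀, l₀, hi₀, hl₀, hil⟩ := hmax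
  obtain ⟨k, e, hk, hen, hes, hek, hemono⟩ :=
    exists_sorted_periodic_enumeration (P := fun i => b i + 1 < a i + n) ⟨i₀, hi₀⟩ a b hchain
  have hm : 0 < m := Fin.pos r₀
  have hL : Monotone fun i => a (e i) + i / k * n := by
    refine monotone_add_ediv_mul (g := fun i => a (e i)) hk (fun i s => by simp only [hek])
      (fun i j h₁ h₂ h₃ => (hemono i j h₁ h₂ h₃).1) ?_
    have := han (e (k - 1))
    have := ha₀ (e 0)
    omega
  have hM : Monotone fun i => b (e i) + i / k * n :=
    monotone_add_ediv_mul (g := fun i => b (e i)) hk (fun i s => by simp only [hek])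
      (fun i j h₁ h₂ h₃ => (hemono i j h₁ h₂ h₃).2) (hwrap _ _ (hen _))
  have hmem : ∀ i x, LiftMem n (a (e i) + i / k * n) (b (e i) + i / k * n) x ↔
      B (e i) (circPoint hn x) := fun i x => by rw [liftMem_shift, hB]
  have hdiv : ∀ i, (i + k) / k = i / k + 1 := fun i => Int.add_ediv_of_dvd_right dvd_rfl |>.trans
    (by rw [Int.ediv_self hk.ne'])
  have hek₁ : ∀ i, e (i + k) = e i := fun i => by simpa using hek i 1
  have hσ : ∀ i : ℤ, 0 ≤ ((e i).val - r₀.val : ℤ) % m ∧ ((e i).val - r₀.val : ℤ) % m < m :=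
    fun i => ⟨Int.emod_nonneg _ (by omega), Int.emod_lt_of_pos _ (by omega)⟩
  have hσe : ∀ i : ℤ, circPoint hm (r₀.val + ((e i).val - r₀.val : ℤ) % m) = e i := by
    intro i
    rw [← circPoint_add_mul hm _ (((e i).val - r₀.val : ℤ) / m), add_assoc, mul_comm,
      Int.emod_add_mul_ediv, add_sub_cancel, circPoint_coe]
  refine no_linear_preorder_of_cyclic_arcs (n := n) (k := k) (N := m)
    (L := fun i => a (e i) + i / k * n) (M := fun i => b (e i) + i / k * n)
    (σ := fun i => ((e i).val - r₀.val : ℤ) % m) (by omega) hk hL hM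
    (fun i => ?_) (fun i => ?_) (fun i => ?_) (fun i => ?_)
    (fun i j x y => hconn _ _ (hen i) (hen j) (i / k) (j / k) x y)
    (fun i => (hσ i).1) (fun i => (hσ i).2.le) (fun i s => by simp only [hek])
    fun x i₁ i₂ i₃ h₁₂ h₂₃ h₁ h₃ h₂ => ?_
  · simp only [hek₁, hdiv]
    ring
  · simp only [hek₁, hdiv]
    ring
  · have := hab (e i)
    omega
  · obtain ⟨r, q, hr, hrk, rfl⟩ := exists_eq_add_mul hk i
    rcases lt_or_ge (r + 1) k with h | h
    · rw [show r + q * k + 1 = (r + 1) + q * k by ring, hek, hek,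
        add_mul_ediv_of_bounds q hr hrk, add_mul_ediv_of_bounds q (by omega) h]
      by_contra! hge
      have h₁ := hen (r + 1)
      have h₂ := han (e (r + 1))
      have h₃ := ha₀ (e r)
      refine hbad ⟨b (e (r + 1)) + 1 - n, by omega, by omega, fun s hs => ?_,
        fun i l hi hl hil' hl' => ?_⟩
      · obtain ⟨t, ht, htk, rfl⟩ := hes s hs
        rcases le_or_gt t r with htr | htr
        · have := (hemono t r ht htr hrk).1
          omega
        · have := (hemono (r + 1) t (by omega) htr htk).2
          omega
      · have := hwrap (e (r + 1)) i h₁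
        omega
    · obtain rfl : r = k - 1 := by omega
      rw [show k - 1 + q * k + 1 = 0 + (q + 1) * k by ring, hek, hek,
        add_mul_ediv_of_bounds q hr hrk, add_mul_ediv_of_bounds (q + 1) le_rfl hk]
      obtain ⟨t, ht, htk, rfl⟩ := hes i₀ hi₀
      obtain ⟨u, hu, huk, rfl⟩ := hes l₀ hl₀
      have h₁ := (hemono 0 t le_rfl ht htk).2
      have h₂ := (hemono u (k - 1) hu (by omega) (by omega)).1
      linarith
  · rw [hmem] at h₁ h₂ h₃
    have hne : ∀ i j, ¬ B (e i) (circPoint hn x) → B (e j) (circPoint hn x) →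
        ((e i).val - r₀.val : ℤ) % m ≠ ((e j).val - r₀.val : ℤ) % m := by
      intro i j hi hj hij
      have := hσe i
      rw [hij, hσe j] at this
      exact hi (this ▸ hj)
    have h₀ : ((e i₁).val - r₀.val : ℤ) % m ≠ 0 := by
      intro h
      have := hσe i₁
      rw [h, add_zero, circPoint_coe] at this
      exact h₁ (this ▸ hr₀ _)
    have h₀₁ := (hσ i₁).1
    have h₁₂' := hne i₁ i₂ h₁ h₂
    have h₂₃' := hne i₃ i₂ h₃ h₂
    have h₃m := (hσ i₃).2
    refine (hcol (circPoint hn x)).not_alternating hm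
      (x := r₀.val) (y := r₀.val + ((e i₁).val - r₀.val : ℤ) % m)
      (z := r₀.val + ((e i₂).val - r₀.val : ℤ) % m)
      (w := r₀.val + ((e i₃).val - r₀.val : ℤ) % m) (by omega) (by omega) (by omega) (by omega)
      ?_ ?_ ?_ ?_
    · rw [circPoint_coe]; exact hr₀ _
    · rw [hσe]; exact h₁
    · rw [hσe]; exact h₂
    · rw [hσe]; exact h₃

/-- a 0/1 matrix with circular ones along rows and columns, no
zero rows, whose row differences (and r - s - t for full r, nontrivial s, t)
are circular intervals, admits a row permutation giving a monotone circular
ordering: the (normalized) left and right endpoints of the circular one-blocks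
are both non-decreasing, while circular ones along columns is preserved. -/
theorem stmt_14 {m n : ℕ} (B : Fin m → Fin n → Prop)
    (hrow : ∀ i, CircBlock {j | B i j})
    (hcol : ∀ j, CircBlock {i | B i j})
    (hnz : ∀ i, ∃ j, B i j)
    (hdiff : ∀ r s, CircBlock {j | B r j ∧ ¬ B s j})
    (hfull : ∀ r s t, (∀ j, B r j) →
        (∃ j, B s j) → (∃ j, ¬ B s j) → (∃ j, B t j) → (∃ j, ¬ B t j) →
        CircBlock {j | B r j ∧ ¬ B s j ∧ ¬ B t j}) :
    ∃ π : Equiv.Perm (Fin m),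
      (∀ j, CircBlock {i | B (π i) j}) ∧
      ∃ lam mu : Fin m → ℕ, Monotone lam ∧ Monotone mu ∧
        ∀ i, lam i < n ∧ lam i ≤ mu i ∧ mu i < lam i + n ∧
          ∀ j : Fin n, B (π i) j ↔ ∃ t, lam i ≤ t ∧ t ≤ mu i ∧ t % n = j.val := by
  rcases Nat.eq_zero_or_pos n with rfl | hn
  · have : IsEmpty (Fin m) := ⟨fun i => (hnz i).choose.elim0⟩
    exact ⟨1, fun j => j.elim0, isEmptyElim, isEmptyElim, isEmptyElim, isEmptyElim, isEmptyElim⟩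
  have hn' : (0 : ℤ) < n := by omega
  choose a b ha₀ han hab hbn hB using fun i => (hrow i).exists_endpoints hn (hnz i)
  simp only [Set.mem_ofPred_eq] at hB
  have hproper : ∀ i, b i + 1 < a i + n → ¬ B i (circPoint hn (b i + 1)) := fun i hi => by
    rw [hB]
    exact not_liftMem_of_lt hn' (by omega) hi
  have hfull_of : ∀ i, ¬ b i + 1 < a i + n → ∀ j, B i j := by
    intro i hi j
    have := hbn i
    have := han i
    have := ha₀ i
    rw [← circPoint_coe hn j, hB, liftMem_iff_of_bounds] <;> omega
  have hinside : ∀ r s (t : ℤ), b r + 1 < a r + n → a r < a s + t * n →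
      b s + t * n < b r → False := by
    intro r s t hr h₁ h₂
    have hs := hab s
    refine (hdiff r s).not_alternating hn (x := a r) (y := a s + t * n) (z := b r)
      (w := b r + 1) h₁ (by omega) (by omega) hr ?_ ?_ ?_ ?_ <;>
      simp only [Set.mem_ofPred_eq, hB r]
    · refine ⟨LiftMem.of_mem le_rfl (hab r), ?_⟩
      rw [hB, ← liftMem_shift t]
      exact not_liftMem hn' h₁ (by omega)
    · refine fun h => h.2 ?_
      rw [hB, ← liftMem_shift t]
      exact LiftMem.of_mem le_rfl (by omega)
    · refine ⟨LiftMem.of_mem (hab r) le_rfl, ?_⟩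
      rw [hB, ← liftMem_shift t]
      exact not_liftMem_of_lt hn' h₂ (by omega)
    · exact fun h => not_liftMem_of_lt hn' (by omega) hr h.1
  have hchain : ∀ r s, b r + 1 < a r + n → b s + 1 < a s + n →
      (a r ≤ a s ∧ b r ≤ b s) ∨ (a s ≤ a r ∧ b s ≤ b r) := by
    intro r s hr hs
    have h₁ := hinside r s 0 hr
    have h₂ := hinside s r 0 hs
    have h₃ := hab r
    have h₄ := hab s
    by_contra! h
    rcases lt_trichotomy (a r) (a s) with h₅ | h₅ | h₅
    · exact h₁ (by omega) (by have := h.1 h₅.le; omega)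
    · have := h.1 h₅.le
      have := h.2 h₅.ge
      omega
    · exact h₂ (by omega) (by have := h.2 h₅.le; omega)
  have hwrap : ∀ r s, b r + 1 < a r + n → b r ≤ b s + n := by
    intro r s hr
    by_contra! h
    exact hinside r s 1 hr (by have := han r; have := ha₀ s; omega) (by omega)
  obtain ⟨L, hL₀, hLn, hL, hLfull⟩ : ∃ L : ℤ, 0 ≤ L ∧ L < n ∧
      (∀ s, b s + 1 < a s + n → a s ≤ L ∨ L + n ≤ b s + 1) ∧
      ((∃ r, ∀ j, B r j) → ∀ i l, b i + 1 < a i + n → b l + 1 < a l + n → b i + 1 < a l →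
        a l ≤ L → False) := by
    by_cases hr : ∃ r, ∀ j, B r j
    · obtain ⟨r₀, hr₀⟩ := hr
      obtain ⟨L, h₁, h₂, h₃, h₄⟩ := exists_full_row_endpoint hn ha₀ han hab hB hcol hchain hwrap
        (fun r s hr hs p q x y h₁ h₂ h₃ h₄ => by
          have hr' := hab r
          have hs' := hab s
          have hpr : B r (circPoint hn (a r + p * n)) := by
            rw [hB, liftMem_add_mul]
            exact LiftMem.of_mem le_rfl hr'
          have hqs : B s (circPoint hn (a s + q * n)) := by
            rw [hB, liftMem_add_mul]
            exact LiftMem.of_mem le_rfl hs'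
          refine (hfull r₀ r s hr₀ ⟨_, hpr⟩ ⟨_, hproper r hr⟩ ⟨_, hqs⟩
            ⟨_, hproper s hs⟩).not_alternating hn h₁ (by omega) h₃ (by omega)
            ⟨hr₀ _, ?_, ?_⟩ (fun h => h.2.1 hpr) ⟨hr₀ _, ?_, ?_⟩ fun h => h.2.2 hqs
          · rw [hB, ← liftMem_shift p]
            exact not_liftMem hn' h₁ (by omega)
          · rw [hB, ← liftMem_shift q]
            exact not_liftMem hn' (by omega) h₄
          · rw [hB, ← liftMem_shift p]
            exact not_liftMem_of_lt hn' h₂ (by omega)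
          · rw [hB, ← liftMem_shift q]
            exact not_liftMem hn' h₃ (by omega)) r₀ hr₀
      exact ⟨L, h₁, h₂, h₃, fun _ => h₄⟩
    · exact ⟨n - 1, by omega, by omega, fun s _ => Or.inl (by have := han s; omega),
        fun h => absurd h hr⟩
  set f : Fin m → ℤ := fun i => if b i + 1 < a i + n then a i else L with hf
  set g : Fin m → ℤ := fun i => if b i + 1 < a i + n then b i else L + n - 1 with hg
  have hfg : ∀ i, 0 ≤ f i ∧ f i < n ∧ f i ≤ g i ∧ g i < f i + n := by
    intro i
    have := ha₀ i
    have := han i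
    have := hab i
    simp only [hf, hg]
    split_ifs <;> omega
  have hBfg : ∀ i (j : Fin n), B i j ↔ (f i ≤ j.val ∧ (j.val : ℤ) ≤ g i) ∨ j.val + n ≤ g i := by
    intro i j
    by_cases h : b i + 1 < a i + n
    · have h₁ := hB i j.val
      rw [circPoint_coe, liftMem_iff_of_bounds (ha₀ i) (han i) (hbn i) (by omega) (by omega)] at h₁
      simp only [hf, hg, if_pos h, h₁]
    · simp only [hf, hg, if_neg h]
      refine ⟨fun _ => ?_, fun _ => hfull_of i h j⟩
      omega
  obtain ⟨π, hπf, hπg⟩ := exists_perm_monotone_monotone f g fun r s => by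
    have h₁ := hL r
    have h₂ := hL s
    have h₃ := hbn r
    have h₄ := hbn s
    have h₅ := hchain r s
    simp only [hf, hg]
    split_ifs with hr hs hs
    · exact h₅ hr hs
    · have := h₁ hr
      omega
    · have := h₂ hs
      omega
    · omega
  refine ⟨π, fun j => circBlock_of_not_alternating ?_ ?_, fun i => (f (π i)).toNat,
    fun i => (g (π i)).toNat, fun i j h => Int.toNat_le_toNat (hπf h),
    fun i j h => Int.toNat_le_toNat (hπg h), fun i => ?_⟩
  · intro i₁ i₂ i₃ i₄ h₁₂ h₂₃ h₃₄ h₁ h₂ h₃ h₄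
    simp only [Set.mem_ofPred_eq, hBfg] at h₁ h₂ h₃ h₄
    have e₁ := hπf h₂₃.le
    have e₂ := hπg h₁₂.le
    have e₃ := hπg h₃₄.le
    simp only [Function.comp_apply] at e₁ e₂ e₃
    omega
  · intro i₁ i₂ i₃ i₄ h₁₂ h₂₃ h₃₄ h₁ h₂ h₃ h₄
    have hlt : ∀ i, ¬ B (π i) j → b (π i) + 1 < a (π i) + n := fun i hi => by
      by_contra h
      exact hi (hfull_of _ h j)
    have hp₁ := hlt i₁ h₁
    have hp₃ := hlt i₃ h₃
    simp only [Set.mem_ofPred_eq, hBfg] at h₁ h₂ h₃ h₄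
    have e₁ := hπf h₁₂.le
    have e₂ := hπg h₂₃.le
    have e₃ := hπf h₃₄.le
    simp only [Function.comp_apply] at e₁ e₂ e₃
    have hg₁ : g (π i₁) = b (π i₁) := if_pos hp₁
    have hf₃ : f (π i₃) = a (π i₃) := if_pos hp₃
    have hb := hfg (π i₁)
    by_cases hp₄ : b (π i₄) + 1 < a (π i₄) + n
    · have hg₄ : g (π i₄) = b (π i₄) := if_pos hp₄
      have := hwrap (π i₄) (π i₁) hp₄
      omega
    · have hf₄ : f (π i₄) = L := if_neg hp₄
      exact hLfull ⟨_, hfull_of _ hp₄⟩ (π i₁) (π i₃) hp₁ hp₃ (by omega) (by omega)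
  · obtain ⟨h₀, h₁, h₂, h₃⟩ := hfg (π i)
    beta_reduce
    refine ⟨by omega, by omega, by omega, fun j => ?_⟩
    rw [hBfg]
    have hj := j.isLt
    constructor
    · rintro (h | h)
      · exact ⟨j, by omega, by omega, Nat.mod_eq_of_lt hj⟩
      · exact ⟨j + n, by omega, by omega, by rw [Nat.add_mod_right, Nat.mod_eq_of_lt hj]⟩
    · rintro ⟨t, ht₁, ht₂, ht⟩
      rcases lt_or_ge t n with h | h
      · rw [Nat.mod_eq_of_lt h] at ht
        omega
      · rw [Nat.mod_eq_sub_mod h, Nat.mod_eq_of_lt (by omega)] at ht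
        omega
end
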